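/- Let θ_a ∈ (0,1), κ > 0, Δ > 0 and let F(θ, p) = (θ(1−θ)((1−p)(1−θ) − Δpθ), κ p(1−p)((1−θ)² − (1−θ_a)²)). Then the set of zeros of F in [0,1]² is exactly the five points (0,0), (0,1), (1,0), (1,1), and the interior point (θ†, p†) = (θ_a, (1−θ_a)/(1 − (1−Δ)θ_a)). -/

import Mathlib

open Set

/-- The zeros of the vector field
`F(θ,p) = (θ(1-θ)((1-p)(1-θ) - Δpθ), κ p(1-p)((1-θ)² - (1-θa)²))`
in `[0,1]²` are exactly the four corners and the interior saddle
`(θa, (1-θa)/(1-(1-Δ)θa))`. -/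
theorem coupled_ode_equilibria
    (θa κ Δ : ℝ) (hθa : θa ∈ Ioo (0:ℝ) 1) (hκ : 0 < κ) (hΔ : 0 < Δ) :
    ∀ x ∈ Icc (0:ℝ) 1 ×ˢ Icc (0:ℝ) 1,
      ((x.1 * (1 - x.1) * ((1 - x.2) * (1 - x.1) - Δ * x.2 * x.1),
        κ * x.2 * (1 - x.2) * ((1 - x.1) ^ 2 - (1 - θa) ^ 2)) = ((0 : ℝ), (0 : ℝ)) ↔
        x ∈ ({(0, 0), (0, 1), (1, 0), (1, 1),
              (θa, (1 - θa) / (1 - (1 - Δ) * θa))} : Set (ℝ × ℝ))) := by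
  obtain ⟨ha0, ha1⟩ := hθa
  have hden : 0 < 1 - (1 - Δ) * θa := by nlinarith [mul_pos hΔ ha0]
  rintro ⟨t, p⟩ ⟨⟨ht0, ht1⟩, -⟩
  dsimp only at ht0 ht1 ⊢
  simp only [Prod.mk.injEq, mem_insert_iff, mem_singleton_iff]
  constructor
  · rintro ⟨h₁, h₂⟩
    have hp : p = 0 ∨ p = 1 ∨ t = θa := by
      rcases mul_eq_zero.1 h₂ with h | h
      · rcases mul_eq_zero.1 h with h | h
        · exact Or.inl ((mul_eq_zero.1 h).resolve_left hκ.ne')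
        · exact Or.inr (Or.inl (by linarith))
      · have h' : (θa - t) * (2 - t - θa) = 0 := by linear_combination h
        rcases mul_eq_zero.1 h' with h' | h'
        · exact Or.inr (Or.inr (by linarith))
        · linarith
    have ht : t = 0 ∨ t = 1 ∨ (1 - p) * (1 - t) - Δ * p * t = 0 := by
      rcases mul_eq_zero.1 h₁ with h | h
      · rcases mul_eq_zero.1 h with h | h
        · exact Or.inl h
        · exact Or.inr (Or.inl (by linarith))
      · exact Or.inr (Or.inr h)
    rcases hp with rfl | rfl | rfl
    · have : t = 0 ∨ t = 1 := by
        rcases ht with h | h | h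
        · exact Or.inl h
        · exact Or.inr h
        · exact Or.inr (by linarith)
      tauto
    · have : t = 0 ∨ t = 1 := by
        rcases ht with h | h | h
        · exact Or.inl h
        · exact Or.inr h
        · have h' : Δ * t = 0 := by linear_combination -h
          exact Or.inl ((mul_eq_zero.1 h').resolve_left hΔ.ne')
      tauto
    · rcases ht with h | h | h
      · exact absurd h ha0.ne'
      · exact absurd h ha1.ne
      · refine Or.inr (Or.inr (Or.inr (Or.inr ⟨rfl, ?_⟩)))
        rw [eq_div_iff hden.ne']
        linear_combination -h
  · rintro (⟨rfl, rfl⟩ | ⟨rfl, rfl⟩ | ⟨rfl, rfl⟩ | ⟨rfl, rfl⟩ | ⟨rfl, hp⟩)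
    iterate 4 norm_num
    rw [eq_div_iff hden.ne'] at hp
    refine ⟨?_, by ring⟩
    linear_combination -(t * (1 - t)) * hp
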